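/- Fix real parameters a > 0 and b ∈ (0,1). Consider the planar vector field F(x, r) = ( a·r − x·(x + b·r), −2r·(x + b·r) ). Then: (i) the origin (0,0) is the unique equilibrium of F in ℝ²; (ii) the region 𝒱 = {(x, r) : r ≥ 0, −r/b ≤ x ≤ a/b} is positively invariant: any solution of the ODE (x', r') = F(x, r) with initial condition in 𝒱 remains in 𝒱 for as long as it is defined in forward time; (iii) the x-axis {r = 0} is invariant, and on it the dynamics are x' = −x², so x is strictly decreasing along the x-axis away from the origin. -/

import Mathlib

/-- The planar system obtained in chart `𝒦̃₂` of the second spherical blow-up of the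
Le Corbeiller analysis, restricted to the invariant plane `σ₂ = 0`; coordinates `(x, r)`. -/
noncomputable def corbSphere2PlanarField (a b : ℝ) (p : ℝ × ℝ) : ℝ × ℝ :=
  (a * p.2 - p.1 * (p.1 + b * p.2), -2 * p.2 * (p.1 + b * p.2))

open Set in
/-- Positivity for the linear differential inequality `f' + c f ≥ 0`, proved with the
integrating factor `exp (∫ c)`. -/
theorem nonneg_of_hasDerivWithinAt_add_mul_nonneg {f f' c : ℝ → ℝ} {T : ℝ} (hT : 0 ≤ T)
    (hc : ContinuousOn c (Icc 0 T))
    (hf : ∀ t ∈ Icc (0 : ℝ) T, HasDerivWithinAt f (f' t) (Icc 0 T) t)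
    (h : ∀ t ∈ Icc (0 : ℝ) T, 0 ≤ f' t + c t * f t) (h0 : 0 ≤ f 0) :
    ∀ t ∈ Icc (0 : ℝ) T, 0 ≤ f t := by
  have hcont : Continuous (IccExtend hT ((Icc 0 T).domRestrict c)) :=
    hc.domRestrict.Icc_extend'
  set k := IccExtend hT ((Icc 0 T).domRestrict c) with hk
  have hkc : ∀ t ∈ Icc (0 : ℝ) T, k t = c t := fun t ht => IccExtend_of_mem hT _ ht
  have hK : ∀ t, HasDerivAt (fun t => ∫ s in (0 : ℝ)..t, k s) (k t) t := fun t =>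
    intervalIntegral.integral_hasDerivAt_right (hcont.intervalIntegrable _ _)
      hcont.stronglyMeasurable.stronglyMeasurableAtFilter hcont.continuousAt
  have hg : ∀ t ∈ Icc (0 : ℝ) T, HasDerivWithinAt
      (fun t => f t * Real.exp (∫ s in (0 : ℝ)..t, k s))
      ((f' t + c t * f t) * Real.exp (∫ s in (0 : ℝ)..t, k s)) (Icc 0 T) t := by
    intro t ht
    refine ((hf t ht).mul (hK t).exp.hasDerivWithinAt).congr_deriv ?_
    rw [hkc t ht]
    ring
  have hmono : MonotoneOn (fun t => f t * Real.exp (∫ s in (0 : ℝ)..t, k s)) (Icc 0 T) :=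
    monotoneOn_of_hasDerivWithinAt_nonneg (convex_Icc 0 T)
      (fun t ht => (hg t ht).continuousWithinAt)
      (fun t ht => (hg t (interior_subset ht)).mono interior_subset)
      (fun t ht => mul_nonneg (h t (interior_subset ht)) (Real.exp_pos _).le)
  intro t ht
  have hle := hmono (left_mem_Icc.2 hT) ht ht.1
  simp only [intervalIntegral.integral_same, Real.exp_zero, mul_one] at hle
  exact nonneg_of_mul_nonneg_left (h0.trans hle) (Real.exp_pos _)

/-- Phase-plane facts for `(x', r') = (ar − x(x + br), −2r(x + br))`: the origin is the
unique equilibrium; the region `𝒱 = {r ≥ 0, −r/b ≤ x ≤ a/b}` is positively invariant;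
and the `x`-axis is invariant with dynamics `x' = −x²`, strictly decreasing away from the
origin. -/
theorem corbSphere2_phase_plane (a b : ℝ) (ha : 0 < a) (hb : b ∈ Set.Ioo (0 : ℝ) 1) :
    (∀ p : ℝ × ℝ, corbSphere2PlanarField a b p = 0 ↔ p = 0) ∧
    (∀ (p : ℝ → ℝ × ℝ) (T : ℝ), 0 ≤ T →
      (∀ t ∈ Set.Icc (0 : ℝ) T,
        HasDerivWithinAt p (corbSphere2PlanarField a b (p t)) (Set.Icc (0 : ℝ) T) t) →
      p 0 ∈ {q : ℝ × ℝ | 0 ≤ q.2 ∧ -q.2 / b ≤ q.1 ∧ q.1 ≤ a / b} →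
      ∀ t ∈ Set.Icc (0 : ℝ) T, p t ∈ {q : ℝ × ℝ | 0 ≤ q.2 ∧ -q.2 / b ≤ q.1 ∧ q.1 ≤ a / b}) ∧
    (∀ x : ℝ, corbSphere2PlanarField a b (x, 0) = (-x ^ 2, 0)) ∧
    (∀ x : ℝ, x ≠ 0 → -x ^ 2 < 0) := by
  obtain ⟨hb0, hb1⟩ := hb
  refine ⟨?_, ?_, ?_, ?_⟩
  · rintro ⟨x, r⟩
    constructor
    · intro h
      simp only [corbSphere2PlanarField, Prod.mk_eq_zero] at h ⊢
      obtain ⟨h1, h2⟩ := h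
      have hr : r = 0 := by
        rcases mul_eq_zero.1 h2 with h3 | h3
        · linarith
        · rw [h3, mul_zero, sub_zero] at h1
          exact (mul_eq_zero.1 h1).resolve_left ha.ne'
      subst hr
      simpa using h1
    · intro h
      simp only [Prod.mk_eq_zero] at h
      simp [corbSphere2PlanarField, h.1, h.2]
  · rintro p T hT hp ⟨hr0, hw0, hx0⟩
    have hx : ∀ t ∈ Set.Icc (0 : ℝ) T, HasDerivWithinAt (fun t => (p t).1)
        (a * (p t).2 - (p t).1 * ((p t).1 + b * (p t).2)) (Set.Icc 0 T) t :=
      fun t ht => (hp t ht).fst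
    have hr : ∀ t ∈ Set.Icc (0 : ℝ) T, HasDerivWithinAt (fun t => (p t).2)
        (-2 * (p t).2 * ((p t).1 + b * (p t).2)) (Set.Icc 0 T) t :=
      fun t ht => (hp t ht).snd
    have hxc : ContinuousOn (fun t => (p t).1) (Set.Icc 0 T) :=
      fun t ht => (hx t ht).continuousWithinAt
    have hrc : ContinuousOn (fun t => (p t).2) (Set.Icc 0 T) :=
      fun t ht => (hr t ht).continuousWithinAt
    have hrpos : ∀ t ∈ Set.Icc (0 : ℝ) T, 0 ≤ (p t).2 :=
      nonneg_of_hasDerivWithinAt_add_mul_nonneg (c := fun t => 2 * ((p t).1 + b * (p t).2))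
        hT (by fun_prop) hr (fun t _ => le_of_eq (by ring)) hr0
    have hvpos : ∀ t ∈ Set.Icc (0 : ℝ) T, 0 ≤ b * (p t).1 + (p t).2 := by
      refine nonneg_of_hasDerivWithinAt_add_mul_nonneg
        (c := fun t => (p t).1 + b * (p t).2 + (p t).2 / b)
        hT (by fun_prop) (fun t ht => ((hx t ht).const_mul b).add (hr t ht)) (fun t ht => ?_) ?_
      · have hbinv : 0 ≤ 1 / b - b := by
          rw [sub_nonneg, le_div_iff₀ hb0]
          nlinarith
        have hpos : 0 ≤ a * b * (p t).2 + (p t).2 ^ 2 * (1 / b - b) := by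
          have := hrpos t ht
          positivity
        refine hpos.trans_eq ?_
        field_simp
        ring
      · rw [div_le_iff₀ hb0] at hw0
        linarith
    have hzpos : ∀ t ∈ Set.Icc (0 : ℝ) T, 0 ≤ a / b - (p t).1 := by
      refine nonneg_of_hasDerivWithinAt_add_mul_nonneg (c := fun t => b * (p t).2)
        hT (by fun_prop) (fun t ht => (hx t ht).const_sub (a / b)) (fun t _ => ?_)
        (sub_nonneg.2 hx0)
      have h : b * (p t).2 * (a / b - (p t).1) = a * (p t).2 - b * (p t).2 * (p t).1 := by
        field_simp
      linarith [sq_nonneg (p t).1]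
    intro t ht
    refine ⟨hrpos t ht, ?_, sub_nonneg.1 (hzpos t ht)⟩
    rw [div_le_iff₀ hb0]
    linarith [hvpos t ht]
  · intro x
    simp [corbSphere2PlanarField, sq]
  · intro x hx
    exact neg_neg_of_pos (by positivity)
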